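/- arXiv:1405.6637 — 12 statements merged into one kernel-verified Lean document; each statement's English description precedes it below -/
import Mathlib

section
/- Let H be a real Hilbert space, F : H → H nonexpansive, and x ∈ H. If there exists a sequence (λ_n) of positive reals with λ_n → ∞ such that the sequence (R_{λ_n} x) is bounded, then the fixed point set Fix F = {p ∈ H : F p = p} is nonempty, closed and convex, and R_λ x converges strongly, as λ → ∞, to P_{Fix F}(x), the nearest point of Fix F to x. -/
open Filter Topology

/-- Monotonicity of `I - F` for a nonexpansive `F`. -/
lemma nonexp_mono {H : Type*} [NormedAddCommGroup H] [InnerProductSpace ℝ H]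
    (F : H → H) (hF : ∀ x y : H, ‖F x - F y‖ ≤ ‖x - y‖) (z w : H) :
    0 ≤ inner ℝ ((z - F z) - (w - F w)) (z - w) := by
  have h1 : (z - F z) - (w - F w) = (z - w) - (F z - F w) := by abel
  rw [h1, inner_sub_left, real_inner_self_eq_norm_sq]
  have h2 := real_inner_le_norm (F z - F w) (z - w)
  have h3 := hF z w
  nlinarith [norm_nonneg (z - w)]

lemma norm_sub_sq_le_of_inner {H : Type*} [NormedAddCommGroup H] [InnerProductSpace ℝ H]
    (u v : H) (h : inner ℝ u (u - v) ≤ 0) : ‖u - v‖ ^ 2 ≤ ‖v‖ ^ 2 - ‖u‖ ^ 2 := by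
  rw [inner_sub_right, real_inner_self_eq_norm_sq] at h
  rw [norm_sub_sq_real]
  linarith

/-- Main monotonicity estimate. -/
lemma key_ineq {H : Type*} [NormedAddCommGroup H] [InnerProductSpace ℝ H]
    (u v : H) (a b : ℝ) (hb : 0 ≤ b) (hab : b < a)
    (h : 0 ≤ inner ℝ (-(a • u) - -(b • v)) (u - v)) : ‖u - v‖ ^ 2 ≤ ‖v‖ ^ 2 - ‖u‖ ^ 2 := by
  apply norm_sub_sq_le_of_inner
  have h1 : -(a • u) - -(b • v) = -(b • (u - v) + (a - b) • u) := by module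
  rw [h1, inner_neg_left, inner_add_left, inner_smul_left, inner_smul_left,
    real_inner_self_eq_norm_sq] at h
  simp only [conj_trivial] at h
  have h2 : 0 ≤ b * ‖u - v‖ ^ 2 := by positivity
  by_contra hc
  push Not at hc
  have := mul_pos (sub_pos.2 hab) hc
  linarith

lemma fix_convex {H : Type*} [NormedAddCommGroup H] [InnerProductSpace ℝ H]
    (F : H → H) (hF : ∀ x y : H, ‖F x - F y‖ ≤ ‖x - y‖) :
    Convex ℝ {p : H | F p = p} := by
  intro p hp q hq a b ha hb hab
  simp only [Set.mem_setOf_eq] at hp hq ⊢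
  obtain rfl : b = 1 - a := by linarith
  generalize hw : F (a • p + (1 - a) • q) = w
  have h1 : ‖w - p‖ ≤ (1 - a) * ‖p - q‖ := by
    have := hF (a • p + (1 - a) • q) p
    rw [hw, hp, show a • p + (1 - a) • q - p = (-(1 - a)) • (p - q) by module, norm_smul,
      norm_neg, Real.norm_of_nonneg hb] at this
    exact this
  have h2 : ‖w - q‖ ≤ a * ‖p - q‖ := by
    have := hF (a • p + (1 - a) • q) q
    rw [hw, hq, show a • p + (1 - a) • q - q = a • (p - q) by module, norm_smul,
      Real.norm_of_nonneg ha] at this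
    exact this
  have e1 : w - (a • p + (1 - a) • q) = a • (w - p) + (1 - a) • (w - q) := by module
  have e2 : p - q = (w - q) - (w - p) := by abel
  have h3 : ‖w - (a • p + (1 - a) • q)‖ ^ 2
      = a * ‖w - p‖ ^ 2 + (1 - a) * ‖w - q‖ ^ 2 - a * (1 - a) * ‖p - q‖ ^ 2 := by
    rw [e1, e2, norm_add_sq_real, norm_sub_sq_real (w - q), norm_smul, norm_smul,
      inner_smul_left, inner_smul_right, Real.norm_of_nonneg ha, Real.norm_of_nonneg hb,
      real_inner_comm (w - p) (w - q)]
    simp only [conj_trivial]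
    ring
  have h1' := mul_le_mul_of_nonneg_left (pow_le_pow_left₀ (norm_nonneg _) h1 2) ha
  have h2' := mul_le_mul_of_nonneg_left (pow_le_pow_left₀ (norm_nonneg _) h2 2) hb
  have h4 : ‖w - (a • p + (1 - a) • q)‖ ^ 2 ≤ 0 := by
    rw [h3]; linarith
  have h5 : ‖w - (a • p + (1 - a) • q)‖ = 0 := by
    apply pow_eq_zero_iff (two_ne_zero) |>.1
    exact le_antisymm h4 (sq_nonneg _)
  exact sub_eq_zero.1 (norm_eq_zero.1 h5)

/-- If the resolvent of a nonexpansive mapping is bounded along some sequence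
`λ_n → ∞`, then the fixed point set is nonempty, closed and convex, and
`R_λ x` converges strongly to the nearest fixed point as `λ → ∞`. -/
theorem resolvent_tendsto_projection_of_bounded
    {H : Type*} [NormedAddCommGroup H] [InnerProductSpace ℝ H] [CompleteSpace H]
    (F : H → H) (hF : ∀ x y : H, ‖F x - F y‖ ≤ ‖x - y‖)
    (R : ℝ → H → H)
    (hR : ∀ l : ℝ, 0 < l → ∀ y : H,
      R l y = (1 / (1 + l)) • y + (l / (1 + l)) • F (R l y))
    (x : H)
    (lam : ℕ → ℝ) (hlam_pos : ∀ n, 0 < lam n)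
    (hlam : Tendsto lam atTop atTop)
    (hbdd : ∃ M : ℝ, ∀ n, ‖R (lam n) x‖ ≤ M) :
    ({p : H | F p = p}).Nonempty ∧ IsClosed {p : H | F p = p} ∧
      Convex ℝ {p : H | F p = p} ∧
      ∃ p : H, F p = p ∧ (∀ q : H, F q = q → ‖x - p‖ ≤ ‖x - q‖) ∧
        Tendsto (fun l : ℝ => R l x) atTop (𝓝 p) := by
  obtain ⟨M, hM⟩ := hbdd
  have hFc : Continuous F := by
    apply LipschitzWith.continuous (K := 1)
    apply LipschitzWith.of_dist_le_mul
    intro y z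
    simpa [dist_eq_norm] using hF y z
  -- displacement formula
  have hA : ∀ l : ℝ, 0 < l → R l x - F (R l x) = -(l⁻¹ • (R l x - x)) := by
    intro l hl
    have h1 : (1 + l) • R l x = x + l • F (R l x) := by
      have h0 := congrArg (fun y => (1 + l) • y) (hR l hl x)
      simp only [smul_add, smul_smul] at h0
      rw [mul_div_cancel₀ _ (by positivity), mul_div_cancel₀ _ (by positivity), one_smul] at h0
      exact h0
    have h2 : l • (R l x - F (R l x)) = l • (-(l⁻¹ • (R l x - x))) := by
      rw [smul_neg, smul_smul, mul_inv_cancel₀ hl.ne', one_smul, smul_sub,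
        sub_eq_iff_eq_add.2]
      rw [add_smul, one_smul] at h1
      rw [← sub_eq_zero] at h1 ⊢
      rw [← h1]
      abel
    exact smul_right_injective H hl.ne' h2
  have hkey : ∀ l m : ℝ, 0 < l → l ≤ m →
      ‖R l x - R m x‖ ^ 2 ≤ ‖R m x - x‖ ^ 2 - ‖R l x - x‖ ^ 2 := by
    intro l m hl hlm
    rcases hlm.eq_or_lt with rfl | hlm
    · simp
    have hm := hl.trans hlm
    have h := nonexp_mono F hF (R l x) (R m x)
    rw [hA l hl, hA m hm, ← sub_sub_sub_cancel_right (R l x) (R m x) x] at h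
    have := key_ineq _ _ _ _ (inv_pos.2 hm).le ((inv_lt_inv₀ hm hl).2 hlm) h
    rwa [sub_sub_sub_cancel_right] at this
  have hq : ∀ q : H, F q = q → ∀ l : ℝ, 0 < l → ‖R l x - x‖ ≤ ‖x - q‖ := by
    intro q hq l hl
    have h := nonexp_mono F hF (R l x) q
    rw [hA l hl, hq, sub_self, ← sub_sub_sub_cancel_right (R l x) q x] at h
    have := key_ineq (R l x - x) (q - x) l⁻¹ 0 le_rfl (inv_pos.2 hl) (by simpa using h)
    rw [norm_sub_rev x q]
    apply le_of_sq_le_sq _ (norm_nonneg _)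
    nlinarith [sq_nonneg ‖R l x - x - (q - x)‖]
  set g : ℝ → ℝ := fun l => ‖R (max l 1) x - x‖ ^ 2 with hg
  have hpos : ∀ l : ℝ, 0 < max l 1 := fun l => lt_max_of_lt_right one_pos
  have hmono : Monotone g := by
    intro l m hlm
    have := hkey _ _ (hpos l) (max_le_max_right 1 hlm)
    simp only [hg]
    nlinarith [sq_nonneg ‖R (max l 1) x - R (max m 1) x‖]
  have hb : BddAbove (Set.range g) := by
    refine ⟨(M + ‖x‖) ^ 2, ?_⟩
    rintro _ ⟨l, rfl⟩
    obtain ⟨n, hn⟩ := (hlam.eventually_ge_atTop (max l 1)).exists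
    have h1 := hkey _ _ (hpos l) hn
    have h2 : ‖R (lam n) x - x‖ ≤ M + ‖x‖ := (norm_sub_le _ _).trans (by gcongr; exact hM n)
    have h3 := pow_le_pow_left₀ (norm_nonneg _) h2 2
    simp only [hg]
    nlinarith [sq_nonneg ‖R (max l 1) x - R (lam n) x‖]
  have hlim := tendsto_atTop_ciSup hmono hb
  have hC : CauchySeq (fun l : ℝ => R (max l 1) x) := by
    apply cauchySeq_of_le_tendsto_0' (fun l => Real.sqrt ((⨆ i, g i) - g l))
    · intro l m hlm
      rw [dist_eq_norm]
      apply Real.le_sqrt_of_sq_le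
      have := hkey _ _ (hpos l) (max_le_max_right 1 hlm)
      exact this.trans (sub_le_sub_right (le_ciSup hb m) _)
    · have := (hlim.const_sub (⨆ i, g i)).sqrt
      simpa using this
  obtain ⟨p, hp'⟩ := cauchySeq_tendsto_of_complete hC
  have hp : Tendsto (fun l : ℝ => R l x) atTop (𝓝 p) := by
    refine hp'.congr' ?_
    filter_upwards [eventually_ge_atTop (1 : ℝ)] with l hl
    rw [max_eq_left hl]
  have hFp : F p = p := by
    have h1 : Tendsto (fun l : ℝ => R l x - F (R l x)) atTop (𝓝 (p - F p)) :=
      hp.sub ((hFc.tendsto p).comp hp)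
    have h2 : Tendsto (fun l : ℝ => -(l⁻¹ • (R l x - x))) atTop (𝓝 (-((0 : ℝ) • (p - x)))) :=
      (tendsto_inv_atTop_zero.smul (hp.sub_const x)).neg
    have h3 := h2.congr' (f₂ := fun l : ℝ => R l x - F (R l x)) (by
      filter_upwards [eventually_gt_atTop (0 : ℝ)] with l hl
      rw [hA l hl])
    have h4 := tendsto_nhds_unique h1 h3
    simp only [zero_smul, neg_zero] at h4
    exact (sub_eq_zero.1 h4).symm
  refine ⟨⟨p, hFp⟩, isClosed_eq hFc continuous_id, fix_convex F hF, p, hFp, ?_, hp⟩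
  intro q hFq
  rw [norm_sub_rev x p]
  refine le_of_tendsto (hp.sub_const x).norm ?_
  filter_upwards [eventually_gt_atTop (0 : ℝ)] with l hl
  exact hq q hFq l hl
end

section
/- Let H be a real Hilbert space, F : H → H nonexpansive, x ∈ H and λ > 0. Then the resolvent satisfies ‖x − R_λ x‖ ≤ λ ‖x − F x‖. -/
open Filter Topology

/-- The resolvent estimate `‖x - R_λ x‖ ≤ λ ‖x - F x‖`. -/
theorem resolvent_dist_le
    {H : Type*} [NormedAddCommGroup H] [InnerProductSpace ℝ H] [CompleteSpace H]
    (F : H → H) (hF : ∀ x y : H, ‖F x - F y‖ ≤ ‖x - y‖)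
    (R : ℝ → H → H)
    (hR : ∀ l : ℝ, 0 < l → ∀ y : H,
      R l y = (1 / (1 + l)) • y + (l / (1 + l)) • F (R l y))
    (x : H) (l : ℝ) (hl : 0 < l) :
    ‖x - R l x‖ ≤ l * ‖x - F x‖ := by
  have h := hR l hl x
  have hF' := hF x (R l x)
  generalize R l x = r at *
  have hne : (1 + l) ≠ 0 := by positivity
  have e : (1 + l) • (x - r) = l • (x - F r) := by
    have h2 : (1 + l) • r = x + l • F r := by
      conv_lhs => rw [h]
      rw [smul_add, smul_smul, smul_smul, mul_div_cancel₀ _ hne, mul_div_cancel₀ _ hne, one_smul]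
    rw [smul_sub, h2]
    module
  have e2 := congrArg norm e
  rw [norm_smul, norm_smul, Real.norm_of_nonneg (by positivity), Real.norm_of_nonneg hl.le] at e2
  have t : ‖x - F r‖ ≤ ‖x - F x‖ + ‖F x - F r‖ := norm_sub_le_norm_sub_add_norm_sub _ _ _
  have t2 := mul_le_mul_of_nonneg_left (t.trans (add_le_add_right hF' _)) hl.le
  linarith
end

section
/- Let H be a real Hilbert space, F : H → H nonexpansive, x ∈ H, t > 0 and n ∈ ℕ, n ≥ 1. Then ‖x − (R_{t/n})^n x‖ ≤ t ‖x − F x‖; consequently, if T_t x denotes the strong limit of (R_{t/n})^n x as n → ∞, then ‖x − T_t x‖ ≤ t ‖x − F x‖. -/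
open Filter Topology

/-- The iterated resolvent estimate `‖x - (R_{t/n})^n x‖ ≤ t ‖x - F x‖` and
its consequence `‖x - T_t x‖ ≤ t ‖x - F x‖` for the strong limit `T_t x`. -/
theorem iterated_resolvent_dist_le
    {H : Type*} [NormedAddCommGroup H] [InnerProductSpace ℝ H] [CompleteSpace H]
    (F : H → H) (hF : ∀ x y : H, ‖F x - F y‖ ≤ ‖x - y‖)
    (R : ℝ → H → H)
    (hR : ∀ l : ℝ, 0 < l → ∀ y : H,
      R l y = (1 / (1 + l)) • y + (l / (1 + l)) • F (R l y))
    (x : H) (t : ℝ) (ht : 0 < t) :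
    (∀ n : ℕ, 1 ≤ n → ‖x - (R (t / n))^[n] x‖ ≤ t * ‖x - F x‖) ∧
      ∀ z : H, Tendsto (fun n : ℕ => (R (t / n))^[n] x) atTop (𝓝 z) →
        ‖x - z‖ ≤ t * ‖x - F x‖ := by
  have key : ∀ l : ℝ, 0 < l → ∀ y : H, (1 + l) • R l y = y + l • F (R l y) := by
    intro l hl y
    have h1 : (1 + l) ≠ 0 := by positivity
    conv_lhs => rw [hR l hl y]
    rw [smul_add, smul_smul, smul_smul, mul_div_cancel₀ _ h1, mul_div_cancel₀ _ h1, one_smul]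
  have hne : ∀ l : ℝ, 0 < l → ∀ y z : H, ‖R l y - R l z‖ ≤ ‖y - z‖ := by
    intro l hl y z
    have e : (1 + l) • (R l y - R l z) = (y - z) + l • (F (R l y) - F (R l z)) := by
      rw [smul_sub, key l hl, key l hl, smul_sub]; abel
    have h2 := norm_add_le (y - z) (l • (F (R l y) - F (R l z)))
    rw [← e, norm_smul, norm_smul, Real.norm_of_nonneg (by positivity),
      Real.norm_of_nonneg hl.le] at h2
    have h3 := mul_le_mul_of_nonneg_left (hF (R l y) (R l z)) hl.le
    linarith
  have hx : ∀ l : ℝ, 0 < l → ‖x - R l x‖ ≤ l * ‖x - F x‖ := by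
    intro l hl
    have e : (1 + l) • (x - R l x) = l • (x - F x) + l • (F x - F (R l x)) := by
      rw [smul_sub, key l hl, smul_sub, smul_sub, add_smul, one_smul]; abel
    have h2 := norm_add_le (l • (x - F x)) (l • (F x - F (R l x)))
    rw [← e, norm_smul, norm_smul, norm_smul, Real.norm_of_nonneg (by positivity),
      Real.norm_of_nonneg hl.le] at h2
    have h3 := mul_le_mul_of_nonneg_left (hF x (R l x)) hl.le
    linarith
  have hit : ∀ l : ℝ, 0 < l → ∀ n : ℕ, ‖x - (R l)^[n] x‖ ≤ n * (l * ‖x - F x‖) := by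
    intro l hl n
    induction n with
    | zero => simp
    | succ k ih =>
      rw [Function.iterate_succ_apply']
      have h1 := norm_sub_le_norm_sub_add_norm_sub x (R l x) (R l ((R l)^[k] x))
      have h2 := hne l hl x ((R l)^[k] x)
      have h3 := hx l hl
      push_cast
      linarith
  have main : ∀ n : ℕ, 1 ≤ n → ‖x - (R (t / n))^[n] x‖ ≤ t * ‖x - F x‖ := by
    intro n hn
    have hn' : (0 : ℝ) < n := by exact_mod_cast hn
    have h := hit (t / n) (by positivity) n
    rwa [← mul_assoc, mul_div_cancel₀ _ hn'.ne'] at h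
  refine ⟨main, fun z hz => ?_⟩
  exact le_of_tendsto (hz.const_sub x).norm (eventually_atTop.2 ⟨1, main⟩)
end

section
/- Let H be a real Hilbert space, F : H → H nonexpansive, x ∈ H and 0 < μ < λ. Then ‖x − R_μ x‖ ≤ ‖x − R_λ x‖ and ‖R_λ x − R_μ x‖² ≤ ‖x − R_λ x‖² − ‖x − R_μ x‖². In particular, λ ↦ ‖x − R_λ x‖ is nondecreasing on (0, ∞). -/
open Filter Topology

theorem resolvent_aux
    {H : Type*} [NormedAddCommGroup H] [InnerProductSpace ℝ H]
    (F : H → H) (hF : ∀ x y : H, ‖F x - F y‖ ≤ ‖x - y‖)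
    (R : ℝ → H → H)
    (hR : ∀ l : ℝ, 0 < l → ∀ y : H,
      R l y = (1 / (1 + l)) • y + (l / (1 + l)) • F (R l y))
    (x : H) (μ l : ℝ) (hμ : 0 < μ) (hμl : μ < l) :
      ‖R l x - R μ x‖ ^ 2 ≤ ‖x - R l x‖ ^ 2 - ‖x - R μ x‖ ^ 2 := by
  have hl : 0 < l := hμ.trans hμl
  have key : ∀ s : ℝ, 0 < s → s • F (R s x) = s • R s x - (x - R s x) := by
    intro s hs
    have h1 : (1 + s) • R s x = x + s • F (R s x) := by
      have h := congrArg (fun z => (1 + s) • z) (hR s hs x)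
      have h2 : (1 + s) ≠ 0 := by positivity
      simp only [smul_add, smul_smul, mul_div_cancel₀ _ h2, one_smul] at h
      exact h
    rw [add_smul, one_smul] at h1
    rw [eq_sub_iff_add_eq, ← sub_eq_zero]
    rw [← sub_eq_zero] at h1
    rw [← neg_eq_zero, ← h1]
    abel
  have k1 := key l hl
  have k2 := key μ hμ
  have hn := hF (R l x) (R μ x)
  set u := R l x
  set v := R μ x
  obtain ⟨b, hb⟩ : ∃ b, b = x - v := ⟨_, rfl⟩
  obtain ⟨d, hd⟩ : ∃ d, d = v - u := ⟨_, rfl⟩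
  have e1 : x - u = b + d := by rw [hb, hd]; abel
  have e2 : u - v = -d := by rw [hd]; abel
  have k3 : (l * μ) • (F u - F v) = -((l * μ) • d + (μ • d - (l - μ) • b)) := by
    have : (l * μ) • (F u - F v) = μ • (l • F u) - l • (μ • F v) := by module
    rw [this, k1, k2, hb, hd]
    module
  have hP : 0 < l * μ := mul_pos hl hμ
  have k4 : ‖(l * μ) • d + (μ • d - (l - μ) • b)‖ ^ 2 ≤ (l * μ) ^ 2 * ‖d‖ ^ 2 := by
    rw [← norm_neg, ← k3, norm_smul, mul_pow, Real.norm_of_nonneg hP.le]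
    rw [e2, norm_neg] at hn
    gcongr
  rw [norm_add_sq_real, norm_smul, mul_pow, Real.norm_of_nonneg hP.le, inner_smul_left,
    inner_sub_right, inner_smul_right, inner_smul_right, real_inner_self_eq_norm_sq] at k4
  simp only [conj_trivial] at k4
  have k5 : μ * ‖d‖ ^ 2 - (l - μ) * inner ℝ d b ≤ 0 := by
    by_contra! hc
    nlinarith [mul_pos hP hc, sq_nonneg ‖μ • d - (l - μ) • b‖]
  have k6 : 0 ≤ inner ℝ d b := by
    by_contra! hc
    nlinarith [mul_pos_of_neg_of_neg hc (sub_neg.2 hμl), sq_nonneg ‖d‖, mul_nonneg hμ.le (sq_nonneg ‖d‖)]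
  rw [e1, e2, norm_neg, ← hb, norm_add_sq_real, real_inner_comm]
  linarith

/-- Monotonicity of `λ ↦ ‖x - R_λ x‖` and the key quadratic inequality
`‖R_λ x - R_μ x‖² ≤ ‖x - R_λ x‖² - ‖x - R_μ x‖²` for `0 < μ < λ`. -/
theorem resolvent_monotonicity
    {H : Type*} [NormedAddCommGroup H] [InnerProductSpace ℝ H] [CompleteSpace H]
    (F : H → H) (hF : ∀ x y : H, ‖F x - F y‖ ≤ ‖x - y‖)
    (R : ℝ → H → H)
    (hR : ∀ l : ℝ, 0 < l → ∀ y : H,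
      R l y = (1 / (1 + l)) • y + (l / (1 + l)) • F (R l y))
    (x : H) (μ l : ℝ) (hμ : 0 < μ) (hμl : μ < l) :
    ‖x - R μ x‖ ≤ ‖x - R l x‖ ∧
      ‖R l x - R μ x‖ ^ 2 ≤ ‖x - R l x‖ ^ 2 - ‖x - R μ x‖ ^ 2 ∧
      MonotoneOn (fun s : ℝ => ‖x - R s x‖) (Set.Ioi (0 : ℝ)) := by
  have h2 := resolvent_aux F hF R hR x
  have h1 : ∀ m s : ℝ, 0 < m → m < s → ‖x - R m x‖ ≤ ‖x - R s x‖ := by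
    intro m s hm hs
    have := h2 m s hm hs
    refine (sq_le_sq₀ (norm_nonneg _) (norm_nonneg _)).1 ?_
    linarith [sq_nonneg ‖R s x - R m x‖]
  refine ⟨h1 μ l hμ hμl, h2 μ l hμ hμl, ?_⟩
  intro m hm s _ hms
  rcases hms.eq_or_lt with h | h
  · subst h
    exact le_rfl
  · exact h1 m s hm h
end

section
/- Let H be a real Hilbert space, F : H → H nonexpansive, x ∈ H, μ > 0, and let p ∈ H be a fixed point of F. Then ‖x − p‖² ≥ ‖x − R_μ x‖² + ‖R_μ x − p‖². -/
open Filter Topology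

/-- For any fixed point `p` of a nonexpansive mapping `F`,
`‖x - p‖² ≥ ‖x - R_μ x‖² + ‖R_μ x - p‖²`. -/
theorem resolvent_pythagoras
    {H : Type*} [NormedAddCommGroup H] [InnerProductSpace ℝ H] [CompleteSpace H]
    (F : H → H) (hF : ∀ x y : H, ‖F x - F y‖ ≤ ‖x - y‖)
    (R : ℝ → H → H)
    (hR : ∀ l : ℝ, 0 < l → ∀ y : H,
      R l y = (1 / (1 + l)) • y + (l / (1 + l)) • F (R l y))
    (x : H) (μ : ℝ) (hμ : 0 < μ) (p : H) (hp : F p = p) :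
    ‖x - R μ x‖ ^ 2 + ‖R μ x - p‖ ^ 2 ≤ ‖x - p‖ ^ 2 := by
  have h1 := hR μ hμ x
  have h2 := hF (R μ x) p
  rw [hp] at h2
  generalize R μ x = r at *
  have hpos : (1 + μ) ≠ 0 := by positivity
  have h3 : (1 + μ) • r = x + μ • F r := by
    have h := congrArg (fun z => (1 + μ) • z) h1
    simp only [smul_add, smul_smul] at h
    rw [mul_one_div_cancel hpos, mul_div_cancel₀ _ hpos, one_smul] at h
    exact h
  have h4 : x - r = μ • ((r - p) - (F r - p)) := by
    have hx : x = (1 + μ) • r - μ • F r := by rw [h3]; abel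
    rw [hx]
    module
  have h5 : 0 ≤ inner ℝ (x - r) (r - p) := by
    rw [h4, real_inner_smul_left, inner_sub_left, real_inner_self_eq_norm_sq]
    apply mul_nonneg hμ.le
    have h6 := real_inner_le_norm (F r - p) (r - p)
    nlinarith [mul_le_mul_of_nonneg_right h2 (norm_nonneg (r - p))]
  have h7 : x - p = (x - r) + (r - p) := by abel
  rw [h7, norm_add_sq_real]
  linarith
end

section
/- Let H be a real Hilbert space, F : H → H nonexpansive, (λ_n) a sequence of positive reals, x₀ ∈ H, and define x_n := R_{λ_n} x_{n−1} for n ≥ 1. Then for every n ≥ 1, ‖x_n − x_{n+1}‖ / λ_{n+1} = ‖x_{n+1} − F x_{n+1}‖ ≤ ‖x_n − F x_n‖ = ‖x_{n−1} − x_n‖ / λ_n; that is, the residuals ‖x_n − F x_n‖ form a nonincreasing sequence. -/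
open Filter Topology

/-- The residual identity `‖x_n - F x_n‖ = ‖x_{n-1} - x_n‖ / λ_n` along the
proximal point iterates, together with the monotonicity of the residuals. -/
theorem ppa_residual_monotone
    {H : Type*} [NormedAddCommGroup H] [InnerProductSpace ℝ H] [CompleteSpace H]
    (F : H → H) (hF : ∀ x y : H, ‖F x - F y‖ ≤ ‖x - y‖)
    (R : ℝ → H → H)
    (hR : ∀ l : ℝ, 0 < l → ∀ y : H,
      R l y = (1 / (1 + l)) • y + (l / (1 + l)) • F (R l y))
    (lam : ℕ → ℝ) (hlam : ∀ n, 0 < lam n)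
    (x : ℕ → H)
    (hx : ∀ n : ℕ, x (n + 1) = R (lam (n + 1)) (x n)) :
    ∀ n : ℕ,
      ‖x (n + 1) - F (x (n + 1))‖ = ‖x n - x (n + 1)‖ / lam (n + 1) ∧
      ‖x (n + 2) - F (x (n + 2))‖ ≤ ‖x (n + 1) - F (x (n + 1))‖ := by
  have key : ∀ n, x n - x (n + 1) = lam (n + 1) • (x (n + 1) - F (x (n + 1))) := by
    intro n
    have hl := hlam (n + 1)
    have h := hR (lam (n + 1)) hl (x n)
    rw [← hx n] at h
    have hne : 1 + lam (n + 1) ≠ 0 := by positivity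
    have h2 : (1 + lam (n + 1)) • x (n + 1) = x n + lam (n + 1) • F (x (n + 1)) := by
      have h3 := congrArg (fun v => (1 + lam (n + 1)) • v) h
      simp only [smul_add, smul_smul, mul_div_cancel₀ _ hne, one_smul] at h3
      exact h3
    have h4 : x n = (1 + lam (n + 1)) • x (n + 1) - lam (n + 1) • F (x (n + 1)) := by
      rw [h2]; abel
    rw [h4]
    module
  intro n
  constructor
  · have hl := hlam (n + 1)
    rw [key n, norm_smul, Real.norm_of_nonneg hl.le]
    field_simp
  · have hl := hlam (n + 2)
    have k := key (n + 1)
    have hf := hF (x (n + 1)) (x (n + 2))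
    change x (n + 1) - x (n + 2) = lam (n + 2) • (x (n + 2) - F (x (n + 2))) at k
    have e : (1 + lam (n + 2)) • (x (n + 2) - F (x (n + 2)))
        = (F (x (n + 1)) - F (x (n + 2))) + (x (n + 1) - F (x (n + 1))) := by
      rw [add_smul, ← k, one_smul]; abel
    have t := norm_add_le (F (x (n + 1)) - F (x (n + 2))) (x (n + 1) - F (x (n + 1)))
    rw [← e, norm_smul, Real.norm_of_nonneg (by positivity)] at t
    rw [k, norm_smul, Real.norm_of_nonneg hl.le] at hf
    linarith
end

section
/- Let H be a real Hilbert space, F : H → H a nonexpansive mapping with at least one fixed point, and (λ_n) a sequence of positive reals with ∑_n λ_n² = ∞. Define x_n := R_{λ_n} x_{n−1} for n ≥ 1 starting from x₀ ∈ H. Then ‖x_m − F x_m‖ → 0 as m → ∞. -/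
open Filter Topology

/-- Asymptotic regularity of the proximal point algorithm:
`‖x_m - F x_m‖ → 0` when `∑ λ_n² = ∞` and `F` has a fixed point. -/
theorem ppa_asymptotic_regularity
    {H : Type*} [NormedAddCommGroup H] [InnerProductSpace ℝ H] [CompleteSpace H]
    (F : H → H) (hF : ∀ x y : H, ‖F x - F y‖ ≤ ‖x - y‖)
    (R : ℝ → H → H)
    (hR : ∀ l : ℝ, 0 < l → ∀ y : H,
      R l y = (1 / (1 + l)) • y + (l / (1 + l)) • F (R l y))
    (hfix : ∃ p : H, F p = p)
    (lam : ℕ → ℝ) (hlam : ∀ n, 0 < lam n)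
    (hsum : ¬ Summable (fun n => (lam n) ^ 2))
    (x : ℕ → H)
    (hx : ∀ n : ℕ, x (n + 1) = R (lam (n + 1)) (x n)) :
    Tendsto (fun m => ‖x m - F (x m)‖) atTop (𝓝 0) := by
  obtain ⟨p, hp⟩ := hfix
  -- monotonicity of `I - F`
  have mono : ∀ u v : H, 0 ≤ inner ℝ ((u - F u) - (v - F v)) (u - v) := by
    intro u v
    have e : (u - F u) - (v - F v) = (u - v) - (F u - F v) := by abel
    rw [e, inner_sub_left, real_inner_self_eq_norm_sq]
    have h1 := real_inner_le_norm (F u - F v) (u - v)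
    have h2 := mul_le_mul_of_nonneg_right (hF u v) (norm_nonneg (u - v))
    nlinarith
  have step : ∀ n, x n = x (n + 1) + lam (n + 1) • (x (n + 1) - F (x (n + 1))) := by
    intro n
    have hl := hlam (n + 1)
    have h := hR (lam (n + 1)) hl (x n)
    rw [← hx n] at h
    have hne : (1 + lam (n + 1)) ≠ 0 := by positivity
    have h2 : (1 + lam (n + 1)) • x (n + 1) = x n + lam (n + 1) • F (x (n + 1)) := by
      conv_lhs => rw [h]
      rw [smul_add, smul_smul, smul_smul, mul_div_cancel₀ _ hne, mul_div_cancel₀ _ hne, one_smul]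
    rw [smul_sub, eq_sub_of_add_eq h2.symm, add_smul, one_smul]
    abel
  have anti : Antitone (fun m => ‖x m - F (x m)‖) := by
    apply antitone_nat_of_succ_le
    intro n
    have hl := hlam (n + 1)
    have h := mono (x n) (x (n + 1))
    have e : x n - x (n + 1) = lam (n + 1) • (x (n + 1) - F (x (n + 1))) :=
      sub_eq_of_eq_add' (step n)
    rw [e, inner_smul_right, inner_sub_left, real_inner_self_eq_norm_sq] at h
    have h0 := nonneg_of_mul_nonneg_right h hl
    have h1 := real_inner_le_norm (x n - F (x n)) (x (n + 1) - F (x (n + 1)))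
    by_contra hc
    push Not at hc
    nlinarith [norm_nonneg (x n - F (x n)), norm_nonneg (x (n + 1) - F (x (n + 1)))]
  have fejer : ∀ n, lam (n + 1) ^ 2 * ‖x (n + 1) - F (x (n + 1))‖ ^ 2
      ≤ ‖x n - p‖ ^ 2 - ‖x (n + 1) - p‖ ^ 2 := by
    intro n
    have hl := hlam (n + 1)
    have h := mono (x (n + 1)) p
    rw [hp, sub_self, sub_zero] at h
    have e : x n - p = (x (n + 1) - p) + lam (n + 1) • (x (n + 1) - F (x (n + 1))) := by
      conv_lhs => rw [step n]
      abel
    rw [e, norm_add_sq_real, inner_smul_right, real_inner_comm, norm_smul, mul_pow,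
      Real.norm_eq_abs, sq_abs]
    nlinarith [mul_nonneg hl.le h]
  have bound : ∀ N, ∑ n ∈ Finset.range N, lam (n + 1) ^ 2 * ‖x (n + 1) - F (x (n + 1))‖ ^ 2
      ≤ ‖x 0 - p‖ ^ 2 := by
    intro N
    have h := Finset.sum_le_sum (fun n (_ : n ∈ Finset.range N) => fejer n)
    rw [Finset.sum_range_sub' (fun n => ‖x n - p‖ ^ 2)] at h
    nlinarith [sq_nonneg ‖x N - p‖]
  have key : ∀ ε > 0, ∃ N, ‖x N - F (x N)‖ < ε := by
    intro ε hε
    by_contra hc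
    push Not at hc
    apply hsum
    rw [← summable_nat_add_iff 1]
    have hs : Summable (fun n => lam (n + 1) ^ 2 * ‖x (n + 1) - F (x (n + 1))‖ ^ 2) :=
      summable_of_sum_range_le (fun n => by positivity) bound
    refine Summable.of_nonneg_of_le (fun n => by positivity) (fun n => ?_)
      (hs.mul_left ((ε ^ 2)⁻¹))
    rw [inv_mul_eq_div, le_div_iff₀ (by positivity)]
    have := hc (n + 1)
    gcongr
  rw [Metric.tendsto_atTop]
  intro ε hε
  obtain ⟨N, hN⟩ := key ε hε
  refine ⟨N, fun n hn => ?_⟩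
  rw [Real.dist_eq, sub_zero, abs_of_nonneg (norm_nonneg _)]
  exact lt_of_le_of_lt (anti hn) hN
end

section
/- Let H be a real Hilbert space, F : H → H nonexpansive, and (T_t)_{t≥0} the semigroup generated by F. Then for every x ∈ H, the function t ↦ ‖T_t x − F(T_t x)‖ is nonincreasing on [0, ∞); in particular ‖T_t x − F(T_t x)‖ ≤ ‖x − F x‖ for all t ≥ 0, and the limit lim_{t→∞} ‖T_t x − F(T_t x)‖ exists. -/
open Filter Topology

/-- The residual `t ↦ ‖T_t x - F (T_t x)‖` along the semigroup generated by a
nonexpansive mapping is nonincreasing, bounded by `‖x - F x‖`, and has a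
limit as `t → ∞`. -/
theorem semigroup_residual_antitone
    {H : Type*} [NormedAddCommGroup H] [InnerProductSpace ℝ H] [CompleteSpace H]
    (F : H → H) (hF : ∀ x y : H, ‖F x - F y‖ ≤ ‖x - y‖)
    (R : ℝ → H → H)
    (hR : ∀ l : ℝ, 0 < l → ∀ y : H,
      R l y = (1 / (1 + l)) • y + (l / (1 + l)) • F (R l y))
    (T : ℝ → H → H)
    (hTlim : ∀ t : ℝ, 0 ≤ t → ∀ x : H,
      Tendsto (fun n : ℕ => (R (t / n))^[n] x) atTop (𝓝 (T t x)))
    (hT0 : ∀ x : H, T 0 x = x)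
    (hTsemi : ∀ s t : ℝ, 0 ≤ s → 0 ≤ t → ∀ x : H, T (s + t) x = T s (T t x))
    (hTne : ∀ t : ℝ, 0 ≤ t → ∀ x y : H, ‖T t x - T t y‖ ≤ ‖x - y‖)
    (hTcont : ∀ x : H, ContinuousOn (fun t => T t x) (Set.Ici (0 : ℝ)))
    (x : H) :
    AntitoneOn (fun t : ℝ => ‖T t x - F (T t x)‖) (Set.Ici (0 : ℝ)) ∧
      (∀ t : ℝ, 0 ≤ t → ‖T t x - F (T t x)‖ ≤ ‖x - F x‖) ∧
      ∃ L : ℝ, Tendsto (fun t : ℝ => ‖T t x - F (T t x)‖) atTop (𝓝 L) := by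
  have step : ∀ l : ℝ, 0 < l → ∀ y : H, ‖R l y - F (R l y)‖ ≤ ‖y - F y‖ := by
    intro l hl y
    have h := hR l hl y
    set z := R l y with hz
    have h1 : (1 + l) • z = y + l • F z := by
      have h2 : (1 + l) • z = (1 + l) • ((1 / (1 + l)) • y + (l / (1 + l)) • F z) :=
        congrArg _ h
      rw [h2, smul_add, smul_smul, smul_smul, mul_one_div_cancel (by positivity),
        mul_div_cancel₀ _ (by positivity), one_smul]
    have e1 : l • (z - F z) = y - z := by
      have h3 : z + l • z = y + l • F z := by rw [← h1, add_smul, one_smul]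
      have h4 : y = z + l • z - l • F z := by rw [h3]; abel
      rw [h4, smul_sub]; abel
    have e2 : ‖y - z‖ = l * ‖z - F z‖ := by
      rw [← e1, norm_smul, Real.norm_of_nonneg hl.le]
    have e3 : (1 + l) • (z - F z) = (y - F y) + (F y - F z) := by
      rw [add_smul, one_smul, e1]; abel
    have e4 : (1 + l) * ‖z - F z‖ ≤ ‖y - F y‖ + ‖y - z‖ := by
      calc (1 + l) * ‖z - F z‖ = ‖(1 + l) • (z - F z)‖ := by
            rw [norm_smul, Real.norm_of_nonneg (by positivity)]
        _ ≤ ‖y - F y‖ + ‖F y - F z‖ := by rw [e3]; exact norm_add_le _ _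
        _ ≤ _ := by linarith [hF y z]
    linarith
  have iter : ∀ l : ℝ, 0 < l → ∀ (n : ℕ) (y : H),
      ‖(R l)^[n] y - F ((R l)^[n] y)‖ ≤ ‖y - F y‖ := by
    intro l hl n y
    induction n with
    | zero => simp
    | succ k ih =>
      rw [Function.iterate_succ_apply']
      exact (step l hl _).trans ih
  have hFc : Continuous F :=
    (LipschitzWith.of_dist_le_mul (K := 1) (by
      intro a b; simpa [dist_eq_norm] using hF a b)).continuous
  have bound : ∀ t : ℝ, 0 ≤ t → ∀ y : H, ‖T t y - F (T t y)‖ ≤ ‖y - F y‖ := by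
    intro t ht y
    rcases ht.eq_or_lt with rfl | ht0
    · rw [hT0]
    · have hc : Continuous (fun z : H => ‖z - F z‖) := by fun_prop
      refine le_of_tendsto ((hc.tendsto _).comp (hTlim t ht y)) ?_
      filter_upwards [eventually_gt_atTop 0] with n hn
      have : (0 : ℝ) < n := by exact_mod_cast hn
      exact iter (t / n) (by positivity) n y
  have anti : AntitoneOn (fun t : ℝ => ‖T t x - F (T t x)‖) (Set.Ici (0 : ℝ)) := by
    intro a ha b hb hab
    have h := bound (b - a) (by linarith) (T a x)
    rw [← hTsemi (b - a) a (by linarith) ha x, sub_add_cancel] at h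
    exact h
  refine ⟨anti, fun t ht => bound t ht x, ?_⟩
  have hg : Antitone (fun t : ℝ => ‖T (max t 0) x - F (T (max t 0) x)‖) := by
    intro a b hab
    exact anti (le_max_right a 0) (le_max_right b 0) (max_le_max_right 0 hab)
  refine ⟨_, (tendsto_atTop_ciInf hg ⟨0, ?_⟩).congr' ?_⟩
  · rintro _ ⟨t, rfl⟩
    exact norm_nonneg _
  · filter_upwards [eventually_ge_atTop 0] with t ht
    rw [max_eq_left ht]
end

section
/- Let H be a real Hilbert space, F : H → H nonexpansive, and (T_t)_{t≥0} the semigroup generated by F. Then for every x ∈ H and all 0 ≤ s ≤ t, ‖T_s x − T_t x‖ ≤ ∫_s^t ‖T_r x − F(T_r x)‖ dr. -/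
open Filter Topology

lemma resolvent_key
    {H : Type*} [NormedAddCommGroup H] [InnerProductSpace ℝ H]
    (F : H → H) (hF : ∀ x y : H, ‖F x - F y‖ ≤ ‖x - y‖)
    (R : ℝ → H → H)
    (hR : ∀ l : ℝ, 0 < l → ∀ y : H,
      R l y = (1 / (1 + l)) • y + (l / (1 + l)) • F (R l y))
    (l : ℝ) (hl : 0 < l) :
    (∀ x y : H, ‖R l x - R l y‖ ≤ ‖x - y‖) ∧ (∀ y : H, ‖R l y - y‖ ≤ l * ‖y - F y‖) := by
  have hl1 : (1 + l) ≠ 0 := by positivity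
  have e : ∀ y, (1 + l) • R l y = y + l • F (R l y) := by
    intro y
    conv_lhs => rw [hR l hl y]
    rw [smul_add, smul_smul, smul_smul, mul_div_cancel₀ _ hl1, mul_div_cancel₀ _ hl1, one_smul]
  constructor
  · intro x y
    have h1 : (1 + l) • (R l x - R l y) = (x - y) + l • (F (R l x) - F (R l y)) := by
      rw [smul_sub, e x, e y, smul_sub]; abel
    have h2 := norm_add_le (x - y) (l • (F (R l x) - F (R l y)))
    rw [← h1, norm_smul, norm_smul, Real.norm_of_nonneg hl.le,
      Real.norm_of_nonneg (by positivity)] at h2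
    have h3 := mul_le_mul_of_nonneg_left (hF (R l x) (R l y)) hl.le
    linarith
  · intro y
    have h1 : (1 + l) • (R l y - y) = l • (F (R l y) - F y) + l • (F y - y) := by
      rw [smul_sub, e y, smul_sub, smul_sub, add_smul, one_smul]; abel
    have h2 := norm_add_le (l • (F (R l y) - F y)) (l • (F y - y))
    rw [← h1, norm_smul, norm_smul, norm_smul, Real.norm_of_nonneg hl.le,
      Real.norm_of_nonneg (by positivity : 0 ≤ 1 + l), norm_sub_rev (F y) y] at h2
    have h3 := mul_le_mul_of_nonneg_left (hF (R l y) y) hl.le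
    linarith

/-- The integral estimate `‖T_s x - T_t x‖ ≤ ∫_s^t ‖T_r x - F (T_r x)‖ dr`
along the semigroup generated by a nonexpansive mapping. -/
theorem semigroup_integral_estimate
    {H : Type*} [NormedAddCommGroup H] [InnerProductSpace ℝ H] [CompleteSpace H]
    (F : H → H) (hF : ∀ x y : H, ‖F x - F y‖ ≤ ‖x - y‖)
    (R : ℝ → H → H)
    (hR : ∀ l : ℝ, 0 < l → ∀ y : H,
      R l y = (1 / (1 + l)) • y + (l / (1 + l)) • F (R l y))
    (T : ℝ → H → H)
    (hTlim : ∀ t : ℝ, 0 ≤ t → ∀ x : H,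
      Tendsto (fun n : ℕ => (R (t / n))^[n] x) atTop (𝓝 (T t x)))
    (hT0 : ∀ x : H, T 0 x = x)
    (hTsemi : ∀ s t : ℝ, 0 ≤ s → 0 ≤ t → ∀ x : H, T (s + t) x = T s (T t x))
    (hTne : ∀ t : ℝ, 0 ≤ t → ∀ x y : H, ‖T t x - T t y‖ ≤ ‖x - y‖)
    (hTcont : ∀ x : H, ContinuousOn (fun t => T t x) (Set.Ici (0 : ℝ)))
    (x : H) (s t : ℝ) (hs : 0 ≤ s) (hst : s ≤ t) :
    ‖T s x - T t x‖ ≤ ∫ r in s..t, ‖T r x - F (T r x)‖ := by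
  have key : ∀ h : ℝ, 0 < h → ∀ y : H, ‖T h y - y‖ ≤ h * ‖y - F y‖ := by
    intro h hh y
    refine le_of_tendsto ((hTlim h hh.le y).sub_const y).norm ?_
    filter_upwards [eventually_gt_atTop 0] with n hn
    have hn' : (0 : ℝ) < n := by exact_mod_cast hn
    obtain ⟨h1, h2⟩ := resolvent_key F hF R hR (h / n) (by positivity)
    have h3 : ∀ m : ℕ, ‖(R (h / n))^[m] y - y‖ ≤ m * (h / n * ‖y - F y‖) := by
      intro m
      induction m with
      | zero => simp
      | succ k ih =>
        rw [Function.iterate_succ_apply']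
        have h4 := norm_sub_le_norm_sub_add_norm_sub
          (R (h / n) ((R (h / n))^[k] y)) (R (h / n) y) y
        have h5 := h1 ((R (h / n))^[k] y) y
        have h6 := h2 y
        push_cast
        linarith
    refine (h3 n).trans (le_of_eq ?_)
    field_simp
  have key2 : ∀ a b : ℝ, 0 ≤ a → a < b →
      ‖T b x - T a x‖ ≤ (b - a) * ‖T a x - F (T a x)‖ := by
    intro a b ha hab
    have h1 := hTsemi (b - a) a (by linarith) ha x
    rw [sub_add_cancel] at h1
    rw [h1]
    exact key (b - a) (by linarith) _
  have hFc : Continuous F :=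
    (LipschitzWith.of_dist_le_mul (K := 1) (fun a b => by
      simpa [dist_eq_norm] using hF a b)).continuous
  have hg : ContinuousOn (fun r => ‖T r x - F (T r x)‖) (Set.Ici 0) :=
    ((hTcont x).sub (hFc.comp_continuousOn (hTcont x))).norm
  have hsub : Set.Icc s t ⊆ Set.Ici (0 : ℝ) := fun r hr => hs.trans hr.1
  have hint : ∀ r, s ≤ r → IntervalIntegrable (fun r => ‖T r x - F (T r x)‖)
      MeasureTheory.volume s r := by
    intro r hr
    apply ContinuousOn.intervalIntegrable
    rw [Set.uIcc_of_le hr]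
    exact hg.mono (fun r hr => hs.trans hr.1)
  have main := image_le_of_liminf_slope_right_le_deriv_boundary
    (f := fun r => ‖T r x - T s x‖) (a := s) (b := t)
    (B := fun r => ∫ u in s..r, ‖T u x - F (T u x)‖)
    (B' := fun r => ‖T r x - F (T r x)‖)
    ((((hTcont x).mono hsub).sub continuousOn_const).norm)
    (by simp)
    (by
      have := intervalIntegral.continuousOn_primitive_interval'
        (hint t hst) (Set.left_mem_uIcc)
      rwa [Set.uIcc_of_le hst] at this)
    (by
      intro r hr
      have hr0 : 0 ≤ r := hs.trans hr.1
      have hsr : Set.Ici r ⊆ Set.Ici (0 : ℝ) := fun u hu => hr0.trans hu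
      refine intervalIntegral.integral_hasDerivWithinAt_right (hint r hr.1) (t := Set.Ioi r) ?_ ?_
      · exact ⟨Set.Ioi r, self_mem_nhdsWithin,
          (hg.mono (Set.Ioi_subset_Ici_self.trans hsr)).aestronglyMeasurable measurableSet_Ioi⟩
      · exact (hg r hr0).mono (Set.Ioi_subset_Ici_self.trans hsr))
    (by
      intro r hr q hq
      apply Eventually.frequently
      filter_upwards [self_mem_nhdsWithin] with z hz
      have hz' : 0 < z - r := sub_pos.2 hz
      refine lt_of_le_of_lt ?_ hq
      rw [slope_def_field, div_le_iff₀ hz', mul_comm]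
      refine le_trans ?_ (key2 r z (hs.trans hr.1) hz)
      have := norm_sub_norm_le (T z x - T s x) (T r x - T s x)
      simpa using this)
    (Set.right_mem_Icc.2 hst)
  rw [norm_sub_rev]
  exact main
end

section
/- Let H be a real Hilbert space, F : H → H nonexpansive, and (T_t)_{t≥0} the semigroup generated by F. Then for every x ∈ H and every t ≥ 0, e^t ‖T_t x − F(T_t x)‖ ≤ ∫_0^t (e^r − 1) ‖T_r x − F(T_r x)‖ dr + ‖F(T_t x) − x‖, and consequently (e^t − 1) ‖T_t x − F(T_t x)‖ ≤ ∫_0^t (e^r − 1) ‖T_r x − F(T_r x)‖ dr + ‖T_t x − x‖. -/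
open Filter Topology

theorem aux_step {H : Type*} [NormedAddCommGroup H] [InnerProductSpace ℝ H]
    (F : H → H) (hF : ∀ x y : H, ‖F x - F y‖ ≤ ‖x - y‖) (l : ℝ) (hl : 0 < l) (y z : H)
    (hz : z = (1 / (1 + l)) • y + (l / (1 + l)) • F z) :
    z - y = l • (F z - z) ∧ ‖F z - z‖ ≤ ‖F y - y‖ := by
  have h1 : (1 + l) • z = y + l • F z := by
    have h0 : (1 + l) ≠ 0 := by positivity
    conv_lhs => rw [hz]
    rw [smul_add, smul_smul, smul_smul, mul_div_cancel₀ _ h0, mul_div_cancel₀ _ h0, one_smul]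
  have h2 : z - y = l • (F z - z) := by
    rw [add_smul, one_smul] at h1
    rw [smul_sub, sub_eq_sub_iff_add_eq_add, h1, add_comm]
  refine ⟨h2, ?_⟩
  have h3 : (1 + l) • (F z - z) = F z - y := by
    rw [add_smul, one_smul, ← h2]; abel
  have h4 : (1 + l) * ‖F z - z‖ = ‖F z - y‖ := by
    rw [← h3, norm_smul, Real.norm_of_nonneg (by positivity)]
  have h5 : ‖z - y‖ = l * ‖F z - z‖ := by
    rw [h2, norm_smul, Real.norm_of_nonneg hl.le]
  have h6 : ‖F z - y‖ ≤ ‖F z - F y‖ + ‖F y - y‖ := norm_sub_le_norm_sub_add_norm_sub _ _ _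
  have h7 := hF z y
  linarith

theorem aux_iter {H : Type*} [NormedAddCommGroup H] [InnerProductSpace ℝ H]
    (F : H → H) (hF : ∀ x y : H, ‖F x - F y‖ ≤ ‖x - y‖) (l : ℝ) (hl : 0 < l) (Rl : H → H)
    (hR : ∀ y, Rl y = (1 / (1 + l)) • y + (l / (1 + l)) • F (Rl y)) (x : H) (k : ℕ) :
    ‖F (Rl^[k] x) - Rl^[k] x‖ ≤ ‖F x - x‖ ∧ ‖Rl^[k] x - x‖ ≤ k * l * ‖F x - x‖ ∧
    ‖Rl^[k] x - x - (k * l) • (F x - x)‖ ≤ 2 * (k * l) ^ 2 * ‖F x - x‖ := by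
  induction k with
  | zero => simp
  | succ k ih =>
    obtain ⟨i1, i2, i3⟩ := ih
    rw [Function.iterate_succ_apply']
    set y := Rl^[k] x
    obtain ⟨a, b⟩ := aux_step F hF l hl y (Rl y) (hR y)
    set z := Rl y
    have hM : 0 ≤ ‖F x - x‖ := norm_nonneg _
    have hz : ‖F z - z‖ ≤ ‖F x - x‖ := b.trans i1
    have hzy : ‖z - y‖ ≤ l * ‖F x - x‖ := by
      rw [a, norm_smul, Real.norm_of_nonneg hl.le]; gcongr
    have hzx : ‖z - x‖ ≤ (k + 1) * l * ‖F x - x‖ := by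
      have := norm_sub_le_norm_sub_add_norm_sub z y x
      linarith
    refine ⟨hz, by push_cast; exact hzx, ?_⟩
    have e : z - x - (((k + 1 : ℕ) : ℝ) * l) • (F x - x) =
        (y - x - (k * l) • (F x - x)) + l • ((F z - F x) - (z - x)) := by
      have : z = y + l • (F z - z) := by rw [← a]; abel
      calc z - x - (((k + 1 : ℕ) : ℝ) * l) • (F x - x)
          = (y + l • (F z - z)) - x - (((k + 1 : ℕ) : ℝ) * l) • (F x - x) := by rw [← this]
        _ = _ := by push_cast; module
    have n1 : ‖l • ((F z - F x) - (z - x))‖ ≤ l * (2 * ((k + 1) * l * ‖F x - x‖)) := by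
      rw [norm_smul, Real.norm_of_nonneg hl.le]
      have := norm_sub_le (F z - F x) (z - x)
      have := hF z x
      gcongr
      linarith
    rw [e]
    refine (norm_add_le _ _).trans ((add_le_add i3 n1).trans ?_)
    push_cast
    have : 0 ≤ (k : ℝ) * l ^ 2 * ‖F x - x‖ := by positivity
    nlinarith

theorem aux_main {H : Type*} [NormedAddCommGroup H] [InnerProductSpace ℝ H] [CompleteSpace H]
    (F : H → H) (hF : ∀ x y : H, ‖F x - F y‖ ≤ ‖x - y‖) (v : ℝ → H) (hv : Continuous v)
    (hd : ∀ s, 0 ≤ s → HasDerivWithinAt v (F (v s) - v s) (Set.Ioi s) s) (t : ℝ) (ht : 0 ≤ t) :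
    Real.exp t * ‖v t - F (v t)‖ ≤
      (∫ r in (0 : ℝ)..t, (Real.exp r - 1) * ‖v r - F (v r)‖) + ‖F (v t) - v 0‖ := by
  have hFc : Continuous F := by
    refine (LipschitzWith.of_dist_le_mul (K := 1) fun x y => ?_).continuous
    simpa [dist_eq_norm] using hF x y
  have hFv : Continuous (fun r => F (v r)) := hFc.comp hv
  set g : ℝ → ℝ := fun r => ‖v r - F (v r)‖ with hg
  have gc : Continuous g := (hv.sub hFv).norm
  set G : ℝ → ℝ := fun r => ∫ s in (0 : ℝ)..r, g s with hG
  have dG : ∀ r, HasDerivAt G (g r) r := fun r => gc.integral_hasStrictDerivAt 0 r |>.hasDerivAt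
  have Gc : Continuous G := continuous_iff_continuousAt.2 fun r => (dG r).continuousAt
  have hinc : ∀ r ∈ Set.Icc 0 t, ‖F (v r) - F (v t)‖ ≤ G t - G r := by
    intro r hr
    have e : ∫ s in r..t, (F (v s) - v s) = v t - v r :=
      intervalIntegral.integral_eq_sub_of_hasDeriv_right hv.continuousOn
        (fun s hs => hd s (by
          rw [min_eq_left hr.2] at hs; exact hr.1.trans hs.1.le))
        ((hFv.sub hv).intervalIntegrable _ _)
    have e2 : G t - G r = ∫ s in r..t, g s :=
      intervalIntegral.integral_interval_sub_left (gc.intervalIntegrable _ _)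
        (gc.intervalIntegrable _ _)
    refine (hF _ _).trans ?_
    rw [norm_sub_rev, ← e, e2]
    refine (intervalIntegral.norm_integral_le_integral_norm hr.2).trans (le_of_eq ?_)
    simp only [hg, norm_sub_rev]
  have e1 : ∫ r in (0 : ℝ)..t, Real.exp r • (F (v r) - F (v t)) =
      Real.exp t • (v t - F (v t)) - Real.exp 0 • (v 0 - F (v t)) := by
    refine intervalIntegral.integral_eq_sub_of_hasDeriv_right
      (f := fun r => Real.exp r • (v r - F (v t)))
      (Real.continuous_exp.smul (hv.sub continuous_const)).continuousOn (fun s hs => ?_)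
      ((Real.continuous_exp.smul (hFv.sub continuous_const)).intervalIntegrable _ _)
    rw [min_eq_left ht] at hs
    have := (Real.hasDerivAt_exp s).hasDerivWithinAt.smul
      ((hd s hs.1.le).sub_const (F (v t)))
    exact this.congr_deriv (by module)
  have e2 : ∫ r in (0 : ℝ)..t, (Real.exp r * (G t - G r) - (Real.exp r - 1) * g r) =
      (Real.exp t - 1) * (G t - G t) - (Real.exp 0 - 1) * (G t - G 0) := by
    refine intervalIntegral.integral_eq_sub_of_hasDerivAt
      (f := fun r => (Real.exp r - 1) * (G t - G r)) (fun s hs => ?_) ?_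
    · have := ((Real.hasDerivAt_exp s).sub_const 1).mul ((dG s).const_sub (G t))
      exact this.congr_deriv (by ring)
    · apply Continuous.intervalIntegrable
      fun_prop
  rw [intervalIntegral.integral_sub (by apply Continuous.intervalIntegrable; fun_prop)
    (by apply Continuous.intervalIntegrable; fun_prop)] at e2
  simp only [sub_self, mul_zero, Real.exp_zero, zero_mul] at e2
  have e3 : ‖∫ r in (0 : ℝ)..t, Real.exp r • (F (v r) - F (v t))‖ ≤
      ∫ r in (0 : ℝ)..t, Real.exp r * (G t - G r) := by
    refine intervalIntegral.norm_integral_le_of_norm_le ht ?_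
      (by apply Continuous.intervalIntegrable; fun_prop)
    refine Filter.Eventually.of_forall fun r hr => ?_
    rw [norm_smul, Real.norm_of_nonneg (Real.exp_pos r).le]
    gcongr
    exact hinc r ⟨hr.1.le, hr.2⟩
  have e4 : Real.exp t • (v t - F (v t)) =
      (∫ r in (0 : ℝ)..t, Real.exp r • (F (v r) - F (v t))) + (v 0 - F (v t)) := by
    rw [e1, Real.exp_zero, one_smul, sub_add_cancel]
  have e5 : Real.exp t * ‖v t - F (v t)‖ = ‖Real.exp t • (v t - F (v t))‖ := by
    rw [norm_smul, Real.norm_of_nonneg (Real.exp_pos t).le]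
  rw [e5, e4, norm_sub_rev (F (v t))]
  refine (norm_add_le _ _).trans ?_
  linarith

/-- The exponential-weight inequalities for the residual along the semigroup
generated by a nonexpansive mapping. -/
theorem semigroup_exponential_estimates
    {H : Type*} [NormedAddCommGroup H] [InnerProductSpace ℝ H] [CompleteSpace H]
    (F : H → H) (hF : ∀ x y : H, ‖F x - F y‖ ≤ ‖x - y‖)
    (R : ℝ → H → H)
    (hR : ∀ l : ℝ, 0 < l → ∀ y : H,
      R l y = (1 / (1 + l)) • y + (l / (1 + l)) • F (R l y))
    (T : ℝ → H → H)
    (hTlim : ∀ t : ℝ, 0 ≤ t → ∀ x : H,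
      Tendsto (fun n : ℕ => (R (t / n))^[n] x) atTop (𝓝 (T t x)))
    (hT0 : ∀ x : H, T 0 x = x)
    (hTsemi : ∀ s t : ℝ, 0 ≤ s → 0 ≤ t → ∀ x : H, T (s + t) x = T s (T t x))
    (hTne : ∀ t : ℝ, 0 ≤ t → ∀ x y : H, ‖T t x - T t y‖ ≤ ‖x - y‖)
    (hTcont : ∀ x : H, ContinuousOn (fun t => T t x) (Set.Ici (0 : ℝ)))
    (x : H) (t : ℝ) (ht : 0 ≤ t) :
    Real.exp t * ‖T t x - F (T t x)‖ ≤
        (∫ r in (0 : ℝ)..t, (Real.exp r - 1) * ‖T r x - F (T r x)‖) +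
          ‖F (T t x) - x‖ ∧
      (Real.exp t - 1) * ‖T t x - F (T t x)‖ ≤
        (∫ r in (0 : ℝ)..t, (Real.exp r - 1) * ‖T r x - F (T r x)‖) +
          ‖T t x - x‖ := by
  have hq : ∀ y : H, ∀ h : ℝ, 0 < h →
      ‖T h y - y - h • (F y - y)‖ ≤ 2 * h ^ 2 * ‖F y - y‖ := by
    intro y h hh
    refine le_of_tendsto (((hTlim h hh.le y).sub_const y).sub_const (h • (F y - y))).norm ?_
    filter_upwards [eventually_gt_atTop 0] with n hn
    have hn' : (0 : ℝ) < n := by exact_mod_cast hn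
    have := (aux_iter F hF (h / n) (by positivity) (R (h / n)) (hR _ (by positivity)) y n).2.2
    rwa [mul_div_cancel₀ _ hn'.ne'] at this
  set v : ℝ → H := fun r => T (max r 0) x with hvdef
  have hv : Continuous v :=
    (hTcont x).comp_continuous (continuous_id.max continuous_const) 
      (fun r => Set.mem_Ici.2 (le_max_right _ _))
  have hvT : ∀ r, 0 ≤ r → v r = T r x := fun r hr => by simp [hvdef, max_eq_left hr]
  have hd : ∀ s, 0 ≤ s → HasDerivWithinAt v (F (v s) - v s) (Set.Ioi s) s := by
    intro s hs
    rw [hasDerivWithinAt_iff_isLittleO]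
    have hO : (fun r => v r - v s - (r - s) • (F (v s) - v s)) =O[𝓝[>] s]
        fun r => (r - s) ^ 2 := by
      refine Asymptotics.IsBigO.of_bound (2 * ‖F (v s) - v s‖) ?_
      filter_upwards [self_mem_nhdsWithin] with r hr
      have hr' : 0 < r - s := sub_pos.2 hr
      have := hq (v s) (r - s) hr'
      have e : v r = T (r - s) (v s) := by
        rw [hvT s hs, ← hTsemi _ _ hr'.le hs, sub_add_cancel, hvT r (by linarith)]
      rw [e, Real.norm_of_nonneg (by positivity)]
      linarith
    refine hO.trans_isLittleO ?_
    have h1 : (fun r : ℝ => (r - s) * (r - s)) =o[𝓝[>] s] fun r => 1 * (r - s) := by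
      refine Asymptotics.IsLittleO.mul_isBigO ?_ (Asymptotics.isBigO_refl _ _)
      rw [Asymptotics.isLittleO_one_iff]
      refine Tendsto.mono_left ?_ nhdsWithin_le_nhds
      have : Continuous fun r : ℝ => r - s := by fun_prop
      simpa using this.tendsto s
    simpa [sq] using h1
  have key := aux_main F hF v hv hd t ht
  have hi : (∫ r in (0 : ℝ)..t, (Real.exp r - 1) * ‖v r - F (v r)‖) =
      ∫ r in (0 : ℝ)..t, (Real.exp r - 1) * ‖T r x - F (T r x)‖ := by
    refine intervalIntegral.integral_congr fun r hr => ?_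
    rw [Set.uIcc_of_le ht] at hr
    simp only [hvT r hr.1]
  rw [hi, hvT t ht, hvT 0 le_rfl, hT0] at key
  refine ⟨key, ?_⟩
  have h1 := norm_sub_le_norm_sub_add_norm_sub (F (T t x)) (T t x) x
  rw [norm_sub_rev (F (T t x)) (T t x)] at h1
  linarith
end

section
/- Let H be a real Hilbert space, F : H → H a nonexpansive mapping with at least one fixed point, and (T_t)_{t≥0} the semigroup generated by F. Then for every x ∈ H, ‖T_t x − F(T_t x)‖ → 0 as t → ∞; moreover lim_{t→∞} ‖T_t x − F(T_t x)‖ = limsup_{h→∞} ‖T_h x − x‖ / h, and this quantity is independent of x. -/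
open Filter Topology

theorem resolvent_step {H : Type*} [NormedAddCommGroup H] [InnerProductSpace ℝ H]
    (F : H → H) (hF : ∀ x y : H, ‖F x - F y‖ ≤ ‖x - y‖) (p : H) (hp : F p = p)
    (l : ℝ) (hl : 0 < l) (u v : H) (huv : v = (1 / (1 + l)) • u + (l / (1 + l)) • F v) :
    ‖v - p‖ ^ 2 + l * ‖v - F v‖ ^ 2 ≤ ‖u - p‖ ^ 2 ∧ ‖v - F v‖ ≤ ‖u - F u‖ := by
  have hl1 : (1 + l) ≠ 0 := by positivity
  have hu : u = v + l • (v - F v) := by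
    have h : (1 + l) • v = u + l • F v := by
      conv_lhs => rw [huv]
      rw [smul_add, smul_smul, smul_smul, mul_div_cancel₀ _ hl1, mul_div_cancel₀ _ hl1, one_smul]
    have h2 : u = (1 + l) • v - l • F v := by rw [h]; abel
    rw [h2]; module
  constructor
  · have h1 : ‖(v - p) - (v - F v)‖ ≤ ‖v - p‖ := by
      have := hF v p
      rw [hp] at this
      convert this using 2
      abel
    have h2 : ‖(v - p) - (v - F v)‖ ^ 2 ≤ ‖v - p‖ ^ 2 := by gcongr
    rw [norm_sub_sq_real] at h2
    have h3 : u - p = (v - p) + l • (v - F v) := by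
      conv_lhs => rw [hu]
      abel
    rw [h3, norm_add_sq_real, inner_smul_right, norm_smul]
    have := mul_nonneg hl.le (sub_nonneg.2 h2)
    nlinarith [sq_nonneg (‖l‖ * ‖v - F v‖)]
  · have h1 : ‖F u - F v‖ ≤ l * ‖v - F v‖ := by
      have := hF u v
      have h2 : u - v = l • (v - F v) := by
        conv_lhs => rw [hu]
        abel
      rwa [h2, norm_smul, Real.norm_of_nonneg hl.le] at this
    have h2 : (1 + l) • (v - F v) = (u - F u) + (F u - F v) := by
      have h3 : (u - F u) + (F u - F v) = u - F v := by abel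
      rw [h3]
      conv_rhs => rw [hu]
      module
    have h3 := norm_add_le (u - F u) (F u - F v)
    rw [← h2, norm_smul, Real.norm_of_nonneg (by positivity)] at h3
    linarith

theorem resolvent_iter {H : Type*} [NormedAddCommGroup H] [InnerProductSpace ℝ H]
    (F : H → H) (hF : ∀ x y : H, ‖F x - F y‖ ≤ ‖x - y‖) (p : H) (hp : F p = p)
    (l : ℝ) (hl : 0 < l) (R : H → H)
    (hR : ∀ y : H, R y = (1 / (1 + l)) • y + (l / (1 + l)) • F (R y)) (x : H) (k : ℕ) :
    ‖R^[k] x - p‖ ^ 2 + k * l * ‖R^[k] x - F (R^[k] x)‖ ^ 2 ≤ ‖x - p‖ ^ 2 := by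
  induction k with
  | zero => simp
  | succ k ih =>
    rw [Function.iterate_succ_apply']
    obtain ⟨h1, h2⟩ := resolvent_step F hF p hp l hl (R^[k] x) (R (R^[k] x)) (hR _)
    have h3 : k * l * ‖R (R^[k] x) - F (R (R^[k] x))‖ ^ 2
        ≤ k * l * ‖R^[k] x - F (R^[k] x)‖ ^ 2 := by gcongr
    push_cast
    linarith

/-- Asymptotic regularity of the semigroup generated by a nonexpansive
mapping with a fixed point: the residual tends to `0`, it equals the
limsup of `‖T_h x - x‖ / h`, and the latter is independent of `x`. -/
theorem semigroup_asymptotic_regularity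
    {H : Type*} [NormedAddCommGroup H] [InnerProductSpace ℝ H] [CompleteSpace H]
    (F : H → H) (hF : ∀ x y : H, ‖F x - F y‖ ≤ ‖x - y‖)
    (R : ℝ → H → H)
    (hR : ∀ l : ℝ, 0 < l → ∀ y : H,
      R l y = (1 / (1 + l)) • y + (l / (1 + l)) • F (R l y))
    (T : ℝ → H → H)
    (hTlim : ∀ t : ℝ, 0 ≤ t → ∀ x : H,
      Tendsto (fun n : ℕ => (R (t / n))^[n] x) atTop (𝓝 (T t x)))
    (hT0 : ∀ x : H, T 0 x = x)
    (hTsemi : ∀ s t : ℝ, 0 ≤ s → 0 ≤ t → ∀ x : H, T (s + t) x = T s (T t x))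
    (hTne : ∀ t : ℝ, 0 ≤ t → ∀ x y : H, ‖T t x - T t y‖ ≤ ‖x - y‖)
    (hTcont : ∀ x : H, ContinuousOn (fun t => T t x) (Set.Ici (0 : ℝ)))
    (hfix : ∃ p : H, F p = p) :
    ∀ x : H,
      Tendsto (fun t : ℝ => ‖T t x - F (T t x)‖) atTop (𝓝 0) ∧
      Filter.limsup (fun h : ℝ => ‖T h x - x‖ / h) atTop = 0 ∧
      ∀ y : H, Filter.limsup (fun h : ℝ => ‖T h x - x‖ / h) atTop =
        Filter.limsup (fun h : ℝ => ‖T h y - y‖ / h) atTop := by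
  obtain ⟨p, hp⟩ := hfix
  have hFc : Continuous F := by
    have : LipschitzWith 1 F := LipschitzWith.of_dist_le_mul fun x y => by
      simpa [dist_eq_norm] using hF x y
    exact this.continuous
  have key : ∀ x : H, ∀ t : ℝ, 0 < t →
      ‖T t x - p‖ ^ 2 + t * ‖T t x - F (T t x)‖ ^ 2 ≤ ‖x - p‖ ^ 2 := by
    intro x t ht
    have hc : Continuous fun z : H => ‖z - p‖ ^ 2 + t * ‖z - F z‖ ^ 2 := by fun_prop
    refine le_of_tendsto ((hc.tendsto (T t x)).comp (hTlim t ht.le x)) ?_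
    filter_upwards [eventually_gt_atTop 0] with n hn
    have hn' : (0 : ℝ) < n := by exact_mod_cast hn
    have hl : 0 < t / n := by positivity
    have := resolvent_iter F hF p hp (t / n) hl (R (t / n)) (hR _ hl) x n
    rwa [mul_div_cancel₀ _ hn'.ne'] at this
  have hlim : ∀ x : H, Tendsto (fun h : ℝ => ‖T h x - x‖ / h) atTop (𝓝 0) := by
    intro x
    refine squeeze_zero' (g := fun h : ℝ => (2 * ‖x - p‖) / h) ?_ ?_
      (tendsto_const_nhds.div_atTop tendsto_id)
    · filter_upwards [eventually_gt_atTop 0] with t ht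
      positivity
    · filter_upwards [eventually_gt_atTop 0] with t ht
      have h0 : 0 ≤ t * ‖T t x - F (T t x)‖ ^ 2 := by positivity
      have h1 : ‖T t x - p‖ ≤ ‖x - p‖ :=
        le_of_not_gt fun hh => by nlinarith [key x t ht, norm_nonneg (x - p)]
      have h2 := norm_sub_le_norm_sub_add_norm_sub (T t x) p x
      rw [norm_sub_rev p x] at h2
      gcongr
      linarith
  intro x
  refine ⟨?_, (hlim x).limsup_eq, fun y => by rw [(hlim x).limsup_eq, (hlim y).limsup_eq]⟩
  have hsq : Tendsto (fun t : ℝ => ‖T t x - F (T t x)‖ ^ 2) atTop (𝓝 0) := by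
    refine squeeze_zero' (g := fun t : ℝ => ‖x - p‖ ^ 2 / t) ?_ ?_
      (tendsto_const_nhds.div_atTop tendsto_id)
    · exact Eventually.of_forall fun t => by positivity
    · filter_upwards [eventually_gt_atTop 0] with t ht
      rw [le_div_iff₀ ht]
      nlinarith [key x t ht, sq_nonneg ‖T t x - p‖]
  have := (Real.continuous_sqrt.tendsto 0).comp hsq
  simpa [Function.comp_def, Real.sqrt_sq] using this
end

section
/- Let H be a real Hilbert space and f : H → ℝ ∪ {+∞} a proper convex lower semicontinuous function. Fix x₀ ∈ H. If there exists a sequence (λ_n) of positive reals with λ_n → ∞ such that the sequence (J_{λ_n} x₀) is bounded, then f attains its minimum on H, the set Min f of minimizers is nonempty closed and convex, and J_λ x₀ converges strongly, as λ → ∞, to P_{Min f}(x₀), the nearest point of Min f to x₀. -/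
open Filter Topology

/-- Jost's theorem in Hilbert space: if the resolvents `J_{λ_n} x₀` of a
proper convex lsc function are bounded along some `λ_n → ∞`, then `f`
attains its minimum, the set of minimizers is nonempty closed and convex,
and `J_λ x₀` converges strongly to the projection of `x₀` onto it. -/
theorem moreau_yosida_tendsto_projection_of_bounded
    {H : Type*} [NormedAddCommGroup H] [InnerProductSpace ℝ H] [CompleteSpace H]
    (f : H → EReal)
    (hne_bot : ∀ x, f x ≠ ⊥)
    (hproper : ∃ x, f x ≠ ⊤)
    (hlsc : LowerSemicontinuous f)
    (hconv : ∀ x y : H, ∀ t : ℝ, 0 ≤ t → t ≤ 1 →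
      f (t • x + (1 - t) • y) ≤ (t : EReal) * f x + ((1 - t : ℝ) : EReal) * f y)
    (J : ℝ → H → H)
    (hJ : ∀ l : ℝ, 0 < l → ∀ x y : H,
      f (J l x) + ((‖x - J l x‖ ^ 2 / (2 * l) : ℝ) : EReal) ≤
        f y + ((‖x - y‖ ^ 2 / (2 * l) : ℝ) : EReal))
    (x₀ : H)
    (lam : ℕ → ℝ) (hlam_pos : ∀ n, 0 < lam n)
    (hlam : Tendsto lam atTop atTop)
    (hbdd : ∃ M : ℝ, ∀ n, ‖J (lam n) x₀‖ ≤ M) :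
    ({p : H | ∀ y : H, f p ≤ f y}).Nonempty ∧
      IsClosed {p : H | ∀ y : H, f p ≤ f y} ∧
      Convex ℝ {p : H | ∀ y : H, f p ≤ f y} ∧
      ∃ p : H, (∀ y : H, f p ≤ f y) ∧
        (∀ q : H, (∀ y : H, f q ≤ f y) → ‖x₀ - p‖ ≤ ‖x₀ - q‖) ∧
        Tendsto (fun l : ℝ => J l x₀) atTop (𝓝 p) := by
  obtain ⟨M, hM⟩ := hbdd
  obtain ⟨w, hw⟩ := hproper
  -- finite values along the resolvent
  have hfin : ∀ l : ℝ, 0 < l → f (J l x₀) ≠ ⊤ := by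
    intro l hl h
    have h1 := hJ l hl x₀ w
    rw [h, EReal.top_add_coe, top_le_iff] at h1
    lift f w to ℝ using ⟨hw, hne_bot w⟩ with c
    exact EReal.coe_ne_top _ (by rw [EReal.coe_add]; exact h1)
  have hF : ∀ l : ℝ, 0 < l → ∃ c : ℝ, f (J l x₀) = c := fun l hl =>
    ⟨(f (J l x₀)).toReal, (EReal.coe_toReal (hfin l hl) (hne_bot _)).symm⟩
  have hmin : ∀ l : ℝ, 0 < l → ∀ (y : H) (a b : ℝ), f (J l x₀) = a → f y ≤ b →
      a + ‖x₀ - J l x₀‖ ^ 2 / (2 * l) ≤ b + ‖x₀ - y‖ ^ 2 / (2 * l) := by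
    intro l hl y a b ha hb
    have h := (hJ l hl x₀ y).trans (add_le_add_left hb _)
    rw [ha] at h
    exact_mod_cast h
  have key : ∀ l m : ℝ, 0 < l → l ≤ m →
      ‖J l x₀ - J m x₀‖ ^ 2 ≤ 2 * (‖x₀ - J m x₀‖ ^ 2 - ‖x₀ - J l x₀‖ ^ 2) := by
    intro l m hl hlm
    rcases hlm.eq_or_lt with rfl | hlm
    · simp
    have hm : 0 < m := hl.trans hlm
    obtain ⟨a, ha⟩ := hF l hl
    obtain ⟨b, hb⟩ := hF m hm
    have h1 := hmin l hl (J m x₀) a b ha hb.le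
    have h2 := hmin m hm (J l x₀) b a hb ha.le
    have hc := hconv (J l x₀) (J m x₀) (1/2) (by norm_num) (by norm_num)
    rw [ha, hb, ← EReal.coe_mul, ← EReal.coe_mul, ← EReal.coe_add] at hc
    have h3 := hmin l hl _ a _ ha hc
    have hpar : ‖x₀ - ((1/2 : ℝ) • J l x₀ + (1 - 1/2 : ℝ) • J m x₀)‖ ^ 2
        = (‖x₀ - J l x₀‖ ^ 2 + ‖x₀ - J m x₀‖ ^ 2) / 2 - ‖J l x₀ - J m x₀‖ ^ 2 / 4 := by
      have e1 : x₀ - ((1/2 : ℝ) • J l x₀ + (1 - 1/2 : ℝ) • J m x₀)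
          = (1/2 : ℝ) • ((x₀ - J l x₀) + (x₀ - J m x₀)) := by module
      have e2 : J l x₀ - J m x₀ = (x₀ - J m x₀) - (x₀ - J l x₀) := by abel
      rw [e1, e2, norm_smul, mul_pow, norm_add_sq_real,
        norm_sub_sq_real (x₀ - J m x₀) (x₀ - J l x₀),
        real_inner_comm (x₀ - J l x₀) (x₀ - J m x₀)]
      norm_num
      ring
    rw [hpar] at h3
    generalize ‖x₀ - J l x₀‖ ^ 2 = A at *
    generalize ‖x₀ - J m x₀‖ ^ 2 = B at *
    generalize ‖J l x₀ - J m x₀‖ ^ 2 = D at *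
    field_simp at h1 h2 h3
    have hba : b ≤ a := by
      by_contra! hab
      nlinarith [mul_pos (sub_pos.2 hlm) (sub_pos.2 hab)]
    nlinarith [mul_nonneg hl.le (sub_nonneg.2 hba)]
  have dmono : ∀ l m : ℝ, 0 < l → l ≤ m → ‖x₀ - J l x₀‖ ^ 2 ≤ ‖x₀ - J m x₀‖ ^ 2 := by
    intro l m hl hlm
    nlinarith [key l m hl hlm, sq_nonneg ‖J l x₀ - J m x₀‖]
  have hpos : ∀ l : ℝ, 0 < max l 1 := fun l => lt_max_of_lt_right one_pos
  have gmono : Monotone (fun l : ℝ => ‖x₀ - J (max l 1) x₀‖ ^ 2) := fun l m hlm =>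
    dmono _ _ (hpos l) (max_le_max_right 1 hlm)
  have gbdd : BddAbove (Set.range (fun l : ℝ => ‖x₀ - J (max l 1) x₀‖ ^ 2)) := by
    refine ⟨(‖x₀‖ + M) ^ 2, ?_⟩
    rintro _ ⟨l, rfl⟩
    obtain ⟨n, hn⟩ := (hlam.eventually_ge_atTop (max l 1)).exists
    refine (dmono _ _ (hpos l) hn).trans ?_
    exact pow_le_pow_left₀ (norm_nonneg _)
      ((norm_sub_le _ _).trans (add_le_add_right (hM n) _)) 2
  have gcau := (tendsto_atTop_ciSup gmono gbdd).cauchySeq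
  have hcau : CauchySeq (fun l : ℝ => J (max l 1) x₀) := by
    rw [Metric.cauchySeq_iff'] at gcau ⊢
    intro ε hε
    obtain ⟨N, hN⟩ := gcau (ε ^ 2 / 2) (by positivity)
    refine ⟨N, fun n hn => ?_⟩
    have h1 := hN n hn
    rw [Real.dist_eq] at h1
    have h2 := (le_abs_self _).trans_lt h1
    have h3 := key _ _ (hpos N) (max_le_max_right 1 hn)
    rw [dist_comm, dist_eq_norm]
    exact lt_of_pow_lt_pow_left₀ 2 hε.le (by linarith)
  obtain ⟨p, hp⟩ := cauchySeq_tendsto_of_complete hcau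
  have hJp : Tendsto (fun l : ℝ => J l x₀) atTop (𝓝 p) := by
    refine hp.congr' ?_
    filter_upwards [eventually_ge_atTop (1 : ℝ)] with l hl
    rw [max_eq_left hl]
  have hpmin : ∀ y : H, f p ≤ f y := by
    intro y
    by_contra! hlt
    obtain ⟨c, hc1, hc2⟩ := EReal.lt_iff_exists_real_btwn.1 hlt
    obtain ⟨b, hb⟩ : ∃ b : ℝ, f y = b :=
      ⟨(f y).toReal, (EReal.coe_toReal hlt.ne_top (hne_bot _)).symm⟩
    have hbc : b < c := by rw [hb] at hc1; exact_mod_cast hc1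
    have ht : Tendsto (fun l : ℝ => b + ‖x₀ - y‖ ^ 2 / (2 * l)) atTop (𝓝 (b + 0)) :=
      tendsto_const_nhds.add
        (tendsto_const_nhds.div_atTop (tendsto_id.const_mul_atTop two_pos))
    rw [add_zero] at ht
    obtain ⟨l, h1, h2, h3⟩ := ((hJp.eventually (hlsc p c hc2)).and
      ((ht.eventually_lt_const hbc).and (eventually_gt_atTop (0 : ℝ)))).exists
    obtain ⟨a, ha⟩ := hF l h3
    have h4 := hmin l h3 y a b ha hb.le
    have h5 : c < a := by rw [ha] at h1; exact_mod_cast h1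
    have h6 : 0 ≤ ‖x₀ - J l x₀‖ ^ 2 / (2 * l) := by positivity
    linarith
  refine ⟨⟨p, hpmin⟩, ?_, ?_, p, hpmin, ?_, hJp⟩
  · have : {p : H | ∀ y : H, f p ≤ f y} = ⋂ y, f ⁻¹' Set.Iic (f y) := by
      ext q; simp
    rw [this]
    exact isClosed_iInter fun y => hlsc.isClosed_preimage _
  · intro a ha b hb s t hs ht hst y
    obtain rfl : t = 1 - s := by linarith
    have hab : f b = f a := le_antisymm (hb a) (ha b)
    have h := hconv a b s hs (by linarith)
    have hat : f a ≠ ⊤ := ((ha w).trans_lt (lt_top_iff_ne_top.2 hw)).ne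
    have hac : f a = ((f a).toReal : ℝ) := (EReal.coe_toReal hat (hne_bot _)).symm
    refine h.trans (le_trans (le_of_eq ?_) (ha y))
    rw [hab, hac, ← EReal.coe_mul, ← EReal.coe_mul, ← EReal.coe_add]
    congr 1
    ring
  · intro q hq
    have ht : Tendsto (fun l : ℝ => ‖x₀ - J l x₀‖) atTop (𝓝 ‖x₀ - p‖) :=
      (tendsto_const_nhds.sub hJp).norm
    refine le_of_tendsto ht ?_
    filter_upwards [eventually_gt_atTop (0 : ℝ)] with l hl
    obtain ⟨a, ha⟩ := hF l hl
    have h := hmin l hl q a a ha (ha ▸ hq _)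
    have h' := (div_le_div_iff_of_pos_right (by positivity : 0 < 2 * l)).1
      (le_of_add_le_add_left h)
    exact le_of_sq_le_sq h' (norm_nonneg _)
end
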